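/- Let S and A be nonempty finite sets, for each a ∈ A let P_a ∈ ℝ^{S×S} be row-stochastic, γ ∈ [0,1), ρ a probability distribution on S, r : S×A → [0,1], g¹,…,g^I : S×A → [-1,1], φ ∈ (0,1], and ε > 0. Set κ = 2εφ, C₁ = 2/φ, C₂ = (φ+2)/((1−γ)φ), and assume κ ≤ min{φ/2, 1}. Assume: (i) there exists λ̃ ∈ Δ(S×A) with ⟨λ̃, gⁱ⟩ ≥ φ for all i and Σ_a (I − γP_aᵀ)λ̃_a = (1−γ)ρ; (ii) λ* maximizes ⟨λ,r⟩ over λ ∈ Δ(S×A) with ⟨λ,gⁱ⟩ ≥ 0 ∀i and Σ_a (I − γP_aᵀ)λ_a = (1−γ)ρ, and λ*_κ maximizes ⟨λ,r⟩ over the same set with ⟨λ,gⁱ⟩ ≥ κ ∀i; (iii) there exist u* ∈ ℝ^I with u* ≥ 0, ‖u*‖₁ ≤ C₁, and v* ∈ ℝ^S with ‖v*‖_∞ ≤ C₂, such that ⟨λ,r⟩ + Σᵢ u*ᵢ(⟨λ,gⁱ⟩ − κ) + ⟨v*, Σ_a (γP_aᵀ − I)λ_a + (1−γ)ρ⟩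 ≤ ⟨λ*_κ, r⟩ for every λ ∈ ℝ^{S×A} with λ ≥ 0. If λ̄ ∈ Δ(S×A) satisfies ⟨λ*_κ, r⟩ − ⟨λ̄, r⟩ + 2C₁ · max_{i∈[I]} max{κ − ⟨λ̄, gⁱ⟩, 0} + 2C₂ · ‖Σ_a (γP_aᵀ − I)λ̄_a + (1−γ)ρ‖₁ ≤ ε, then: (a) ⟨λ*, r⟩ − ⟨λ̄, r⟩ ≤ 3ε; (b) ⟨λ̄, gⁱ⟩ ≥ εφ for every i ∈ [I]; (c) ‖Σ_a (γP_aᵀ − I)λ̄_a + (1−γ)ρ‖₁ ≤ (1−γ)εφ. -/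

import Mathlib

open Finset

/-- Hölder's inequality for finite sums, `ℓ¹`–`ℓ∞` pairing, as a lower bound. -/
theorem neg_mul_sum_abs_le_sum_mul {ι : Type*} [Fintype ι] {v x : ι → ℝ} {C : ℝ}
    (hv : ∀ i, |v i| ≤ C) : -(C * ∑ i, |x i|) ≤ ∑ i, v i * x i := by
  rw [mul_sum, ← sum_neg_distrib]
  refine sum_le_sum fun i _ => ?_
  have h := neg_abs_le (v i * x i)
  rw [abs_mul] at h
  linarith [mul_le_mul_of_nonneg_right (hv i) (abs_nonneg (x i))]

/-- Nonnegative multipliers of total mass at most `C` pair with a vector bounded below by `-M`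
to at least `-(C * M)`. -/
theorem neg_mul_le_sum_mul_of_neg_le {ι : Type*} [Fintype ι] {u x : ι → ℝ} {C M : ℝ}
    (hu : ∀ i, 0 ≤ u i) (hC : ∑ i, |u i| ≤ C) (hM : 0 ≤ M) (hx : ∀ i, -M ≤ x i) :
    -(C * M) ≤ ∑ i, u i * x i := by
  have h : ∑ i, |u i| * (-M) ≤ ∑ i, u i * x i := sum_le_sum fun i _ => by
    rw [abs_of_nonneg (hu i)]
    exact mul_le_mul_of_nonneg_left (hx i) (hu i)
  rw [← sum_mul] at h
  linarith [mul_le_mul_of_nonneg_right hC hM]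

theorem sum_convexCombination_mul {ι : Type*} [Fintype ι] (t : ℝ) (x y f : ι → ℝ) :
    ∑ p, ((1 - t) * x p + t * y p) * f p
      = (1 - t) * ∑ p, x p * f p + t * ∑ p, y p * f p := by
  rw [mul_sum, mul_sum, ← sum_add_distrib]
  exact sum_congr rfl fun p _ => by ring

/-- Deterministic core of Theorem 2: an occupancy measure with small penalized
duality gap for the κ-conservative LP (κ = 2εφ) is 3ε-optimal for the original
LP, satisfies every inequality constraint with margin εφ, and has small
equality-constraint residual. -/
theorem occupancy_measure_bounds
    {S A : Type*} [Fintype S] [Fintype A] [Nonempty S] [Nonempty A]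
    (I : ℕ) (P : A → S → S → ℝ)
    (hPnn : ∀ a s s', 0 ≤ P a s s') (hProw : ∀ a s, ∑ s', P a s s' = 1)
    (γ : ℝ) (hγ0 : 0 ≤ γ) (hγ1 : γ < 1)
    (ρ : S → ℝ) (hρnn : ∀ s, 0 ≤ ρ s) (hρsum : ∑ s, ρ s = 1)
    (r : S × A → ℝ) (hr0 : ∀ p, 0 ≤ r p) (hr1 : ∀ p, r p ≤ 1)
    (g : Fin I → S × A → ℝ) (hg : ∀ i p, |g i p| ≤ 1)
    (φ : ℝ) (hφ0 : 0 < φ) (hφ1 : φ ≤ 1)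
    (ε : ℝ) (hε : 0 < ε)
    (κ C₁ C₂ : ℝ)
    (hκ : κ = 2 * ε * φ) (hC₁ : C₁ = 2 / φ)
    (hC₂ : C₂ = (φ + 2) / ((1 - γ) * φ))
    (hκ1 : κ ≤ φ / 2) (hκ2 : κ ≤ 1)
    -- (i) Slater point with margin φ
    (lamtil : S × A → ℝ)
    (hlt_nn : ∀ p, 0 ≤ lamtil p) (hlt_sum : ∑ p, lamtil p = 1)
    (hlt_g : ∀ i, φ ≤ ∑ p, lamtil p * g i p)
    (hlt_flow : ∀ s, (∑ a, lamtil (s, a))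
        - γ * ∑ a, ∑ s', P a s' s * lamtil (s', a) = (1 - γ) * ρ s)
    -- (ii) primal maximizers of the original and conservative LPs
    (lamstar : S × A → ℝ)
    (hls_nn : ∀ p, 0 ≤ lamstar p) (hls_sum : ∑ p, lamstar p = 1)
    (hls_g : ∀ i, 0 ≤ ∑ p, lamstar p * g i p)
    (hls_flow : ∀ s, (∑ a, lamstar (s, a))
        - γ * ∑ a, ∑ s', P a s' s * lamstar (s', a) = (1 - γ) * ρ s)
    (hls_opt : ∀ lam : S × A → ℝ, (∀ p, 0 ≤ lam p) → (∑ p, lam p = 1) →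
      (∀ i, 0 ≤ ∑ p, lam p * g i p) →
      (∀ s, (∑ a, lam (s, a))
        - γ * ∑ a, ∑ s', P a s' s * lam (s', a) = (1 - γ) * ρ s) →
      (∑ p, lam p * r p) ≤ ∑ p, lamstar p * r p)
    (lamkap : S × A → ℝ)
    (hlk_nn : ∀ p, 0 ≤ lamkap p) (hlk_sum : ∑ p, lamkap p = 1)
    (hlk_g : ∀ i, κ ≤ ∑ p, lamkap p * g i p)
    (hlk_flow : ∀ s, (∑ a, lamkap (s, a))
        - γ * ∑ a, ∑ s', P a s' s * lamkap (s', a) = (1 - γ) * ρ s)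
    (hlk_opt : ∀ lam : S × A → ℝ, (∀ p, 0 ≤ lam p) → (∑ p, lam p = 1) →
      (∀ i, κ ≤ ∑ p, lam p * g i p) →
      (∀ s, (∑ a, lam (s, a))
        - γ * ∑ a, ∑ s', P a s' s * lam (s', a) = (1 - γ) * ρ s) →
      (∑ p, lam p * r p) ≤ ∑ p, lamkap p * r p)
    -- (iii) optimal dual pair with zero duality gap and the Lemma-1 bounds
    (ustar : Fin I → ℝ) (hus_nn : ∀ i, 0 ≤ ustar i)
    (hus_bd : ∑ i, |ustar i| ≤ C₁)
    (vstar : S → ℝ) (hvs_bd : ∀ s, |vstar s| ≤ C₂)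
    (hdual : ∀ lam : S × A → ℝ, (∀ p, 0 ≤ lam p) →
      (∑ p, lam p * r p)
        + (∑ i, ustar i * ((∑ p, lam p * g i p) - κ))
        + (∑ s, vstar s *
            ((∑ a, (γ * (∑ s', P a s' s * lam (s', a)) - lam (s, a)))
              + (1 - γ) * ρ s))
        ≤ ∑ p, lamkap p * r p)
    -- the penalized-gap hypothesis on λ̄
    (lambar : S × A → ℝ)
    (hlb_nn : ∀ p, 0 ≤ lambar p) (hlb_sum : ∑ p, lambar p = 1)
    (hgap : (∑ p, lamkap p * r p) - (∑ p, lambar p * r p)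
        + 2 * C₁ * (⨆ i : Fin I, max (κ - ∑ p, lambar p * g i p) 0)
        + 2 * C₂ * (∑ s,
            |(∑ a, (γ * (∑ s', P a s' s * lambar (s', a)) - lambar (s, a)))
              + (1 - γ) * ρ s|) ≤ ε) :
    ((∑ p, lamstar p * r p) - (∑ p, lambar p * r p) ≤ 3 * ε) ∧
    (∀ i, ε * φ ≤ ∑ p, lambar p * g i p) ∧
    ((∑ s, |(∑ a, (γ * (∑ s', P a s' s * lambar (s', a)) - lambar (s, a)))
        + (1 - γ) * ρ s|) ≤ (1 - γ) * ε * φ) := by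
  set M := ⨆ i : Fin I, max (κ - ∑ p, lambar p * g i p) 0
  set E := ∑ s, |(∑ a, (γ * (∑ s', P a s' s * lambar (s', a)) - lambar (s, a)))
    + (1 - γ) * ρ s|
  have hM0 : 0 ≤ M := Real.iSup_nonneg fun i => le_max_right _ _
  have hE0 : 0 ≤ E := sum_nonneg fun s _ => abs_nonneg _
  have hMi : ∀ i, κ - ∑ p, lambar p * g i p ≤ M := fun i =>
    (le_max_left _ 0).trans (le_ciSup (f := fun i : Fin I => max (κ - ∑ p, lambar p * g i p) 0)
      (Set.finite_range _).bddAbove i)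
  have hγ : 0 < 1 - γ := sub_pos.2 hγ1
  have hC₁φ : C₁ * φ = 2 := by rw [hC₁]; field_simp
  have hC₂φ : C₂ * ((1 - γ) * φ) = φ + 2 := by rw [hC₂]; field_simp
  have hC₁0 : 0 < C₁ := by rw [hC₁]; positivity
  have hC₂0 : 0 < C₂ := by rw [hC₂]; positivity
  have hpen : C₁ * M + C₂ * E ≤ ε := by
    have hd := hdual lambar hlb_nn
    have hu := neg_mul_le_sum_mul_of_neg_le (x := fun i => (∑ p, lambar p * g i p) - κ)
      hus_nn hus_bd hM0 fun i => by linarith [hMi i]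
    have hv := neg_mul_sum_abs_le_sum_mul (x := fun s =>
      (∑ a, (γ * (∑ s', P a s' s * lambar (s', a)) - lambar (s, a))) + (1 - γ) * ρ s) hvs_bd
    linarith
  have hCM : 0 ≤ C₁ * M := by positivity
  have hCE : 0 ≤ C₂ * E := by positivity
  refine ⟨?_, fun i => ?_, ?_⟩
  · -- Mixing the optimum with the Slater point gives a feasible point of the conservative LP.
    have ht : 2 * ε ≤ 1 := by nlinarith
    have hmix := hlk_opt (fun p => (1 - 2 * ε) * lamstar p + 2 * ε * lamtil p)
      (fun p => add_nonneg (mul_nonneg (by linarith) (hls_nn p))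
        (mul_nonneg (by linarith) (hlt_nn p)))
      (by rw [sum_add_distrib, ← mul_sum, ← mul_sum, hls_sum, hlt_sum]; ring)
      (fun i => by
        rw [sum_convexCombination_mul, hκ]
        have h₁ := mul_nonneg (sub_nonneg.2 ht) (hls_g i)
        have h₂ := mul_le_mul_of_nonneg_left (hlt_g i) (by positivity : 0 ≤ 2 * ε)
        linarith)
      (fun s => by
        simp only [mul_add, sum_add_distrib, mul_left_comm (P _ _ _), ← mul_sum]
        linear_combination (1 - 2 * ε) * hls_flow s + 2 * ε * hlt_flow s)
    rw [sum_convexCombination_mul] at hmix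
    have hrt : 0 ≤ ∑ p, lamtil p * r p := sum_nonneg fun p _ => mul_nonneg (hlt_nn p) (hr0 p)
    have hrs : ∑ p, lamstar p * r p ≤ 1 := by
      rw [← hls_sum]
      exact sum_le_sum fun p _ => mul_le_of_le_one_right (hls_nn p) (hr1 p)
    nlinarith
  · have hMφ : 2 * M ≤ ε * φ := by
      have h := mul_le_mul_of_nonneg_right (show C₁ * M ≤ ε by linarith) hφ0.le
      linear_combination h - M * hC₁φ
    linarith [hMi i]
  · have h := mul_le_mul_of_nonneg_right (show C₂ * E ≤ ε by linarith) (mul_pos hγ hφ0).le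
    have hEφ : (φ + 2) * E ≤ (1 - γ) * ε * φ := by linear_combination h - E * hC₂φ
    nlinarith [mul_nonneg hφ0.le hE0]
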